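/- Let f(x, W) = f̃(W₁x, W₂) with f̃ differentiable, let x₁, …, xₙ ∈ ℝ^d be nonzero training points, W* = (W₁*, W₂*) an interpolation solution, and k ≥ 1. Assume: (i) the moment bound (1/n) Σᵢ ‖∇_W f(xᵢ, W*)‖_{2k}^{2k} ≤ 2w(2B)^{k−1}/η^k (the consequence of k-th order linear stability of SGD with learning rate η and batch size B, where w is the number of parameters); (ii) f satisfies the (C, δ_approx, k)-local smoothness condition at each (xᵢ, W*); (iii) δ > 0 satisfies δ ≤ δ_approx ‖xᵢ‖₂/‖W₁*‖₂ for every i; and (iv) the set {x₁, …, xₙ} is (δ, K)-scattered, i.e. Σᵢ₌₁ⁿ 1_{B(xᵢ,δ)}(x) ≤ K for all x ∈ ℝ^d. Then, with X_δ = ∪ᵢ B(xᵢ, δ) of Lebesgue volume V_{X_δ}, the Sobolev seminorm |f(·, W*)|_{1,2k,X_δ} = (∫_{X_δ} ‖∇_x f(x, W*)‖_{2k}^{2k} dx)^{1/(2k)} satisfies |f(·, W*)|_{1,2k,X_δ} ≤ ((K V_{X_δ})^{1/(2k)} · 2C ‖(W₁*)ᵀ‖_{2k} / minᵢ ‖xᵢ‖_{2k})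 · ((w/B)^{1/(2k)} √(2B/η) + 1). -/

import Mathlib

open MeasureTheory

/-- Matrix–vector product of `W : ℝ^{m×d}` (as a function) with `x : ℝ^d`. -/
noncomputable def mVec {m d : ℕ} (W : Fin m → Fin d → ℝ) (x : Fin d → ℝ) : Fin m → ℝ :=
  fun r => ∑ s, W r s * x s

/-- Euclidean (ℓ²) norm of a vector in `ℝ^d`. -/
noncomputable def l2norm {d : ℕ} (v : Fin d → ℝ) : ℝ := Real.sqrt (∑ j, v j ^ 2)

/-- Operator norm of a matrix induced by Euclidean norms. -/
noncomputable def opNorm2 {m d : ℕ} (W : Fin m → Fin d → ℝ) : ℝ :=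
  sSup {r : ℝ | ∃ x : Fin d → ℝ, l2norm x = 1 ∧ r = l2norm (mVec W x)}

/-- ℓ^{2k} norm of a vector. -/
noncomputable def lpnorm (k : ℕ) {d : ℕ} (v : Fin d → ℝ) : ℝ :=
  (∑ j, |v j| ^ (2 * k)) ^ ((2 * k : ℝ))⁻¹

/-- Operator norm of a matrix induced by ℓ^{2k} norms on domain and codomain. -/
noncomputable def opNormP (k : ℕ) {m d : ℕ} (W : Fin m → Fin d → ℝ) : ℝ :=
  sSup {r : ℝ | ∃ x : Fin d → ℝ, lpnorm k x = 1 ∧ r = lpnorm k (mVec W x)}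

/-- Euclidean distance between two (flattened) parameter pairs `W = (W₁, W₂)`. -/
noncomputable def paramDist {m d p : ℕ}
    (W W' : (Fin m → Fin d → ℝ) × (Fin p → ℝ)) : ℝ :=
  Real.sqrt ((∑ r, ∑ s, (W.1 r s - W'.1 r s) ^ 2) + ∑ l, (W.2 l - W'.2 l) ^ 2)

/-- `‖∇_W F‖_{2k}^{2k}` for `F : (W₁, W₂) ↦ ℝ`, over all (flattened) parameters. -/
noncomputable def gradW2kPow {m d p : ℕ} (k : ℕ)
    (F : ((Fin m → Fin d → ℝ) × (Fin p → ℝ)) → ℝ)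
    (W : (Fin m → Fin d → ℝ) × (Fin p → ℝ)) : ℝ :=
  (∑ r, ∑ s, |fderiv ℝ F W (Pi.single r (Pi.single s 1), 0)| ^ (2 * k))
    + ∑ l, |fderiv ℝ F W (0, Pi.single l 1)| ^ (2 * k)

/-- The Euclidean ball of radius `δ` around `c` in `ℝ^d`. -/
def eball {d : ℕ} (c : Fin d → ℝ) (δ : ℝ) : Set (Fin d → ℝ) :=
  {z | l2norm (fun t => z t - c t) ≤ δ}

lemma lpnorm_nonneg (k : ℕ) {d : ℕ} (v : Fin d → ℝ) : 0 ≤ lpnorm k v :=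
  Real.rpow_nonneg (Finset.sum_nonneg fun _ _ => by positivity) _

lemma rpow_inv_two_mul_pow {k : ℕ} (hk : 1 ≤ k) {a : ℝ} (ha : 0 ≤ a) :
    (a ^ ((2 * k : ℝ))⁻¹) ^ (2 * k) = a := by
  have h := Real.rpow_inv_natCast_pow ha (n := 2 * k) (by omega)
  push_cast at h
  exact h

lemma pow_two_mul_rpow_inv {k : ℕ} (hk : 1 ≤ k) {a : ℝ} (ha : 0 ≤ a) :
    (a ^ (2 * k)) ^ ((2 * k : ℝ))⁻¹ = a := by
  have h := Real.pow_rpow_inv_natCast ha (n := 2 * k) (by omega)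
  push_cast at h
  exact h

lemma lpnorm_pow {k : ℕ} (hk : 1 ≤ k) {d : ℕ} (v : Fin d → ℝ) :
    lpnorm k v ^ (2 * k) = ∑ j, |v j| ^ (2 * k) :=
  rpow_inv_two_mul_pow hk (Finset.sum_nonneg fun _ _ => by positivity)

lemma abs_le_lpnorm {k : ℕ} (hk : 1 ≤ k) {d : ℕ} (v : Fin d → ℝ) (j : Fin d) :
    |v j| ≤ lpnorm k v := by
  refine le_of_pow_le_pow_left₀ (n := 2 * k) (by omega) (lpnorm_nonneg k v) ?_
  rw [lpnorm_pow hk]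
  exact Finset.single_le_sum (f := fun j => |v j| ^ (2 * k)) (fun _ _ => by positivity)
    (Finset.mem_univ j)

lemma lpnorm_pos {k : ℕ} (hk : 1 ≤ k) {d : ℕ} {v : Fin d → ℝ} (hv : v ≠ 0) :
    0 < lpnorm k v := by
  obtain ⟨j, hj⟩ := Function.ne_iff.mp hv
  exact (abs_pos.mpr hj).trans_le (abs_le_lpnorm hk v j)

lemma lpnorm_mono (k : ℕ) {d : ℕ} {v w : Fin d → ℝ} (h : ∀ j, |v j| ≤ |w j|) :
    lpnorm k v ≤ lpnorm k w := by
  refine Real.rpow_le_rpow (Finset.sum_nonneg fun _ _ => by positivity) ?_ (by positivity)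
  exact Finset.sum_le_sum fun j _ => pow_le_pow_left₀ (abs_nonneg _) (h j) _

lemma lpnorm_smul {k : ℕ} (hk : 1 ≤ k) {d : ℕ} (c : ℝ) (v : Fin d → ℝ) :
    lpnorm k (c • v) = |c| * lpnorm k v := by
  refine (pow_left_inj₀ (lpnorm_nonneg _ _)
    (mul_nonneg (abs_nonneg c) (lpnorm_nonneg _ _)) (n := 2 * k) (by omega)).mp ?_
  rw [mul_pow, lpnorm_pow hk, lpnorm_pow hk, Finset.mul_sum]
  simp [abs_mul, mul_pow]

lemma lpnorm_one {d : ℕ} (v : Fin d → ℝ) : lpnorm 1 v = l2norm v := by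
  simp [lpnorm, l2norm, Real.sqrt_eq_rpow]

lemma opNormP_one {m d : ℕ} (W : Fin m → Fin d → ℝ) : opNormP 1 W = opNorm2 W := by
  simp only [opNormP, opNorm2, lpnorm_one]

lemma opNormP_nonneg (k : ℕ) {m d : ℕ} (W : Fin m → Fin d → ℝ) : 0 ≤ opNormP k W := by
  refine Real.sSup_nonneg ?_
  rintro _ ⟨_, -, rfl⟩
  exact lpnorm_nonneg _ _

lemma mVec_smul {m d : ℕ} (W : Fin m → Fin d → ℝ) (c : ℝ) (v : Fin d → ℝ) :
    mVec W (c • v) = c • mVec W v := by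
  funext r
  simp only [mVec, Pi.smul_apply, smul_eq_mul, Finset.mul_sum]
  exact Finset.sum_congr rfl fun _ _ => by ring

lemma bddAbove_lpnorm_mVec {k : ℕ} (hk : 1 ≤ k) {m d : ℕ} (W : Fin m → Fin d → ℝ) :
    BddAbove {r : ℝ | ∃ x : Fin d → ℝ, lpnorm k x = 1 ∧ r = lpnorm k (mVec W x)} := by
  refine ⟨lpnorm k (fun r => ∑ s, |W r s|), ?_⟩
  rintro _ ⟨x, hx, rfl⟩
  refine lpnorm_mono k fun r => ?_
  rw [abs_of_nonneg (Finset.sum_nonneg fun s _ => abs_nonneg (W r s))]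
  refine (Finset.abs_sum_le_sum_abs _ _).trans (Finset.sum_le_sum fun s _ => ?_)
  rw [abs_mul]
  exact mul_le_of_le_one_right (abs_nonneg _) (hx ▸ abs_le_lpnorm hk x s)

lemma lpnorm_mVec_le {k : ℕ} (hk : 1 ≤ k) {m d : ℕ} (W : Fin m → Fin d → ℝ)
    (v : Fin d → ℝ) : lpnorm k (mVec W v) ≤ opNormP k W * lpnorm k v := by
  rcases eq_or_ne v 0 with rfl | hv
  · have h : mVec W 0 = (0 : ℝ) • mVec W 0 := by rw [← mVec_smul, zero_smul]
    rw [h, lpnorm_smul hk, abs_zero, zero_mul]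
    exact mul_nonneg (opNormP_nonneg _ _) (lpnorm_nonneg _ _)
  · have hpos := lpnorm_pos hk hv
    have h1 : lpnorm k ((lpnorm k v)⁻¹ • v) = 1 := by
      rw [lpnorm_smul hk, abs_of_pos (inv_pos.mpr hpos), inv_mul_cancel₀ hpos.ne']
    have h2 := le_csSup (bddAbove_lpnorm_mVec hk W) ⟨_, h1, rfl⟩
    rw [mVec_smul, lpnorm_smul hk, abs_of_pos (inv_pos.mpr hpos), ← div_eq_inv_mul,
      div_le_iff₀ hpos] at h2
    exact h2

lemma l2norm_mVec_le {m d : ℕ} (W : Fin m → Fin d → ℝ) (v : Fin d → ℝ) :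
    l2norm (mVec W v) ≤ opNorm2 W * l2norm v := by
  simpa only [lpnorm_one, opNormP_one] using lpnorm_mVec_le le_rfl W v

lemma l2norm_sq {d : ℕ} (v : Fin d → ℝ) : l2norm v ^ 2 = ∑ j, v j ^ 2 :=
  Real.sq_sqrt (Finset.sum_nonneg fun _ _ => sq_nonneg _)

lemma l2norm_pos {d : ℕ} {v : Fin d → ℝ} (hv : v ≠ 0) : 0 < l2norm v :=
  lpnorm_one v ▸ lpnorm_pos le_rfl hv

/-- A displacement of the input can be absorbed in a rank-one perturbation of the first layer. -/
lemma exists_params_mVec_eq {m d p : ℕ} {W : (Fin m → Fin d → ℝ) × (Fin p → ℝ)}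
    {x z : Fin d → ℝ} {δ δa : ℝ} (hx : x ≠ 0) (hδ : 0 < δ)
    (h : δ ≤ δa * l2norm x / opNorm2 W.1) (hz : z ∈ eball x δ) :
    ∃ V : (Fin m → Fin d → ℝ) × (Fin p → ℝ),
      paramDist V W ≤ δa ∧ mVec V.1 x = mVec W.1 z ∧ V.2 = W.2 := by
  have hxpos := l2norm_pos hx
  have hop : 0 < opNorm2 W.1 := by
    refine lt_of_le_of_ne (opNormP_one W.1 ▸ opNormP_nonneg 1 W.1) fun h0 => ?_
    rw [← h0, div_zero] at h
    exact hδ.not_ge h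
  set u := mVec W.1 (fun t => z t - x t) with hu
  refine ⟨(fun r s => W.1 r s + u r * x s / l2norm x ^ 2, W.2), ?_, ?_, rfl⟩
  · have h1 : paramDist (fun r s => W.1 r s + u r * x s / l2norm x ^ 2, W.2) W
        = l2norm u / l2norm x := by
      refine (Real.sqrt_eq_iff_eq_sq (by positivity)
        (div_nonneg (lpnorm_one u ▸ lpnorm_nonneg 1 u) hxpos.le)).mpr ?_
      rw [div_pow, l2norm_sq u]
      simp only [add_sub_cancel_left, sub_self, div_pow, mul_pow]
      simp only [← Finset.sum_div, ← Finset.mul_sum, ← Finset.sum_mul, ← l2norm_sq x]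
      field_simp
      simp
    rw [h1, div_le_iff₀ hxpos]
    rw [le_div_iff₀ hop] at h
    calc l2norm u ≤ opNorm2 W.1 * l2norm (fun t => z t - x t) := l2norm_mVec_le _ _
      _ ≤ opNorm2 W.1 * δ := by gcongr; exact hz
      _ ≤ δa * l2norm x := by linarith
  · funext r
    have h2 : ∑ s, u r * x s / l2norm x ^ 2 * x s = u r := by
      calc ∑ s, u r * x s / l2norm x ^ 2 * x s = u r / l2norm x ^ 2 * ∑ s, x s ^ 2 := by
            rw [Finset.mul_sum]
            exact Finset.sum_congr rfl fun _ _ => by ring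
        _ = u r := by rw [← l2norm_sq]; field_simp
    simp only [mVec, add_mul, Finset.sum_add_distrib, h2]
    simp only [hu, mVec, mul_sub, Finset.sum_sub_distrib]
    ring

section Gradient

variable {m d p : ℕ} {ft : (Fin m → ℝ) → (Fin p → ℝ) → ℝ}

lemma fderiv_param_apply
    (hft : Differentiable ℝ (fun q : (Fin m → ℝ) × (Fin p → ℝ) => ft q.1 q.2))
    (x : Fin d → ℝ) (V H : (Fin m → Fin d → ℝ) × (Fin p → ℝ)) :
    fderiv ℝ (fun V : (Fin m → Fin d → ℝ) × (Fin p → ℝ) => ft (mVec V.1 x) V.2) V H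
      = fderiv ℝ (fun q : (Fin m → ℝ) × (Fin p → ℝ) => ft q.1 q.2) (mVec V.1 x, V.2)
          (mVec H.1 x, H.2) := by
  let T : ((Fin m → Fin d → ℝ) × (Fin p → ℝ)) →L[ℝ] (Fin m → ℝ) × (Fin p → ℝ) :=
    LinearMap.toContinuousLinearMap
      { toFun := fun V => (mVec V.1 x, V.2)
        map_add' := fun U V => by
          ext r <;> simp [mVec, add_mul, Finset.sum_add_distrib]
        map_smul' := fun c V => by
          ext r <;> simp [mVec, Finset.mul_sum, mul_assoc] }
  exact congrArg (· H) (((hft (T V)).hasFDerivAt.comp V T.hasFDerivAt).fderiv)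

lemma fderiv_input_apply
    (hft : Differentiable ℝ (fun q : (Fin m → ℝ) × (Fin p → ℝ) => ft q.1 q.2))
    (W : Fin m → Fin d → ℝ) (b : Fin p → ℝ) (z h : Fin d → ℝ) :
    fderiv ℝ (fun u => ft (mVec W u) b) z h
      = fderiv ℝ (fun q : (Fin m → ℝ) × (Fin p → ℝ) => ft q.1 q.2) (mVec W z, b)
          (mVec W h, 0) := by
  let T : (Fin d → ℝ) →L[ℝ] (Fin m → ℝ) :=
    LinearMap.toContinuousLinearMap
      { toFun := fun u => mVec W u
        map_add' := fun u v => by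
          ext r; simp [mVec, mul_add, Finset.sum_add_distrib]
        map_smul' := fun c u => mVec_smul W c u }
  have hT : HasFDerivAt (fun u => (T u, b)) (T.prod 0) z :=
    T.hasFDerivAt.prodMk (hasFDerivAt_const b z)
  exact congrArg (· h) (((hft (T z, b)).hasFDerivAt.comp z hT).fderiv)

lemma map_prodMk_zero_eq_sum (L : ((Fin m → ℝ) × (Fin p → ℝ)) →L[ℝ] ℝ) (v : Fin m → ℝ) :
    L (v, 0) = ∑ r, v r * L (Pi.single r 1, 0) := by
  have h : ((v, 0) : (Fin m → ℝ) × (Fin p → ℝ)) = ∑ r, v r • (Pi.single r 1, 0) := by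
    ext j
    · simp [Prod.fst_sum, Finset.sum_apply, Pi.single_apply]
    · simp [Prod.snd_sum]
  rw [h, map_sum]
  simp only [map_smul, smul_eq_mul]

/-- If `V` maps `x` to the same hidden features as `W` maps `z`, then the input gradient of the
`W`-model at `z` is controlled by the parameter gradient of the model at `(x, V)`. -/
lemma sum_fderiv_input_pow_le {k : ℕ} (hk : 1 ≤ k)
    (hft : Differentiable ℝ (fun q : (Fin m → ℝ) × (Fin p → ℝ) => ft q.1 q.2))
    {W V : (Fin m → Fin d → ℝ) × (Fin p → ℝ)} {x z : Fin d → ℝ}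
    (h1 : mVec V.1 x = mVec W.1 z) (h2 : V.2 = W.2) :
    (∑ j, |fderiv ℝ (fun u => ft (mVec W.1 u) W.2) z (Pi.single j 1)| ^ (2 * k))
        * lpnorm k x ^ (2 * k)
      ≤ opNormP k (fun s r => W.1 r s) ^ (2 * k)
        * gradW2kPow k (fun V => ft (mVec V.1 x) V.2) V := by
  set L := fderiv ℝ (fun q : (Fin m → ℝ) × (Fin p → ℝ) => ft q.1 q.2) (mVec W.1 z, W.2) with hL
  set a : Fin m → ℝ := fun r => L (Pi.single r 1, 0) with ha
  have hin : ∀ j, fderiv ℝ (fun u => ft (mVec W.1 u) W.2) z (Pi.single j 1)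
      = mVec (fun s r => W.1 r s) a j := fun j => by
    rw [fderiv_input_apply hft, map_prodMk_zero_eq_sum]
    simp [mVec, ha, hL, Pi.single_apply]
  have hpar : ∀ r s, fderiv ℝ (fun V : (Fin m → Fin d → ℝ) × (Fin p → ℝ) =>
      ft (mVec V.1 x) V.2) V (Pi.single r (Pi.single s 1), 0) = a r * x s := fun r s => by
    rw [fderiv_param_apply hft, h1, h2, map_prodMk_zero_eq_sum, Finset.sum_eq_single r]
    · simp [mVec, ha, hL, Pi.single_apply, mul_comm]
    · intro r' _ hr
      simp [mVec, Pi.single_eq_of_ne hr]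
    · simp
  have hgrad : lpnorm k a ^ (2 * k) * lpnorm k x ^ (2 * k)
      ≤ gradW2kPow k (fun V => ft (mVec V.1 x) V.2) V := by
    rw [gradW2kPow, lpnorm_pow hk, lpnorm_pow hk, Finset.sum_mul_sum]
    simp only [hpar, abs_mul, mul_pow]
    exact le_add_of_nonneg_right (Finset.sum_nonneg fun _ _ => by positivity)
  simp only [hin]
  rw [← lpnorm_pow hk]
  calc lpnorm k (mVec (fun s r => W.1 r s) a) ^ (2 * k) * lpnorm k x ^ (2 * k)
      ≤ (opNormP k (fun s r => W.1 r s) * lpnorm k a) ^ (2 * k) * lpnorm k x ^ (2 * k) := by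
        refine mul_le_mul_of_nonneg_right ?_ (pow_nonneg (lpnorm_nonneg _ _) _)
        exact pow_le_pow_left₀ (lpnorm_nonneg _ _) (lpnorm_mVec_le hk _ _) _
    _ = opNormP k (fun s r => W.1 r s) ^ (2 * k)
          * (lpnorm k a ^ (2 * k) * lpnorm k x ^ (2 * k)) := by ring
    _ ≤ _ := mul_le_mul_of_nonneg_left hgrad (pow_nonneg (opNormP_nonneg _ _) _)

end Gradient

lemma gradW2kPow_nonneg {m d p : ℕ} (k : ℕ)
    (F : ((Fin m → Fin d → ℝ) × (Fin p → ℝ)) → ℝ)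
    (W : (Fin m → Fin d → ℝ) × (Fin p → ℝ)) : 0 ≤ gradW2kPow k F W := by
  unfold gradW2kPow
  positivity

lemma isClosed_eball {d : ℕ} (c : Fin d → ℝ) (δ : ℝ) : IsClosed (eball c δ) := by
  unfold eball l2norm
  exact isClosed_le (by fun_prop) continuous_const

lemma volume_eball_lt_top {d : ℕ} (c : Fin d → ℝ) (δ : ℝ) : volume (eball c δ) < ⊤ := by
  refine (measure_mono fun z hz => ?_).trans_lt (measure_closedBall_lt_top (x := c) (r := |δ|))
  rw [Metric.mem_closedBall, dist_pi_le_iff (abs_nonneg δ)]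
  intro j
  have h := abs_le_lpnorm le_rfl (fun t => z t - c t) j
  rw [lpnorm_one] at h
  exact h.trans (le_trans hz (le_abs_self δ))

lemma volume_eball {d : ℕ} (c : Fin d → ℝ) (δ : ℝ) :
    volume (eball c δ) = volume (eball (0 : Fin d → ℝ) δ) := by
  have h : eball c δ = (fun z => z + -c) ⁻¹' eball 0 δ := by
    ext z
    simp [eball, sub_eq_add_neg]
  rw [h, measure_preimage_add_right]

section Balls

variable {n d : ℕ} (x : Fin n → Fin d → ℝ) (δ : ℝ)

lemma integrableOn_sum_indicator_eball (c : Fin n → ℝ) (s : Set (Fin d → ℝ)) :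
    IntegrableOn (fun z => ∑ i, (eball (x i) δ).indicator (fun _ => c i) z) s := by
  refine integrable_finsetSum _ fun i _ => Integrable.integrableOn ?_
  exact (integrable_indicator_iff (isClosed_eball _ _).measurableSet).mpr
    (integrableOn_const (volume_eball_lt_top _ _).ne)

lemma setIntegral_sum_indicator_eball (c : Fin n → ℝ) :
    ∫ z in ⋃ i, eball (x i) δ, ∑ i, (eball (x i) δ).indicator (fun _ => c i) z
      = (∑ i, c i) * (volume (eball (0 : Fin d → ℝ) δ)).toReal := by
  rw [integral_finsetSum, Finset.sum_mul]
  · refine Finset.sum_congr rfl fun i _ => ?_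
    rw [setIntegral_indicator (isClosed_eball _ _).measurableSet,
      Set.inter_eq_right.mpr (Set.subset_iUnion (fun i => eball (x i) δ) i), setIntegral_const,
      Measure.real, volume_eball, smul_eq_mul, mul_comm]
  · intro i _
    exact ((integrable_indicator_iff (isClosed_eball _ _).measurableSet).mpr
      (integrableOn_const (volume_eball_lt_top _ _).ne)).integrableOn

variable {x δ}

lemma card_mul_volume_eball_le {K : ℝ}
    (h : ∀ z, (∑ i, Set.indicator (eball (x i) δ) (fun _ => (1 : ℝ)) z) ≤ K) :
    n * (volume (eball (0 : Fin d → ℝ) δ)).toReal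
      ≤ K * (volume (⋃ i, eball (x i) δ)).toReal := by
  have hfin : volume (⋃ i, eball (x i) δ) < ⊤ :=
    (measure_iUnion_fintype_le _ _).trans_lt
      (ENNReal.sum_lt_top.mpr fun i _ => volume_eball_lt_top (x i) δ)
  have h1 := setIntegral_sum_indicator_eball x δ fun _ => 1
  have h2 : ∫ z in ⋃ i, eball (x i) δ, ∑ i, (eball (x i) δ).indicator (fun _ => (1 : ℝ)) z
      ≤ ∫ _ in ⋃ i, eball (x i) δ, K :=
    integral_mono (integrableOn_sum_indicator_eball x δ _ _) (integrableOn_const hfin.ne) h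
  rw [h1, setIntegral_const, smul_eq_mul, Measure.real] at h2
  simp only [Finset.sum_const, Finset.card_univ, Fintype.card_fin, nsmul_eq_mul, mul_one] at h2
  linarith

end Balls

lemma moment_bound_eq {k : ℕ} (hk : 1 ≤ k) {w b η : ℝ} (hw : 0 ≤ w) (hb : 0 < b) (hη : 0 < η) :
    2 * w * (2 * b) ^ (k - 1) / η ^ k
      = ((w / b) ^ ((2 * k : ℝ))⁻¹ * Real.sqrt (2 * b / η)) ^ (2 * k) := by
  rw [mul_pow (_ ^ _) (√_), rpow_inv_two_mul_pow hk (by positivity), pow_mul, Real.sq_sqrt (by positivity)]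
  obtain ⟨j, rfl⟩ : ∃ j, k = j + 1 := ⟨k - 1, by omega⟩
  rw [Nat.add_sub_cancel, div_pow, pow_succ (2 * b)]
  field_simp


/-- the population Sobolev seminorm of the model over the `δ`-neighborhood
`X_δ` of the training data is bounded, under the stability moment bound, local smoothness and
the `(δ,K)`-scattered condition, by
`((K V_{X_δ})^{1/(2k)} 2C ‖(W₁*)ᵀ‖_{2k}/minᵢ‖xᵢ‖_{2k}) ((w/B)^{1/(2k)} √(2B/η) + 1)`. -/
theorem population_sobolev_seminorm_bound
    {m d p n : ℕ} (hn : 0 < n) (B k : ℕ) (hk : 1 ≤ k) (hB : 1 ≤ B)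
    (η : ℝ) (hη : 0 < η)
    (C δa δ K : ℝ) (hC : 0 < C) (hδa : 0 < δa) (hδ : 0 < δ)
    (ft : (Fin m → ℝ) → (Fin p → ℝ) → ℝ)
    (hft : Differentiable ℝ (fun q : (Fin m → ℝ) × (Fin p → ℝ) => ft q.1 q.2))
    (x : Fin n → Fin d → ℝ) (hx : ∀ i, x i ≠ 0) (y : Fin n → ℝ)
    (Wstar : (Fin m → Fin d → ℝ) × (Fin p → ℝ))
    (hinterp : ∀ i, ft (mVec Wstar.1 (x i)) Wstar.2 = y i)
    (hmom : (1 / (n : ℝ)) *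
        ∑ i, gradW2kPow k (fun V => ft (mVec V.1 (x i)) V.2) Wstar
      ≤ 2 * ((m * d + p : ℕ) : ℝ) * (2 * (B : ℝ)) ^ (k - 1) / η ^ k)
    (hsmooth : ∀ i, ∀ W' : (Fin m → Fin d → ℝ) × (Fin p → ℝ), paramDist W' Wstar ≤ δa →
      (gradW2kPow k (fun V => ft (mVec V.1 (x i)) V.2) W') ^ ((2 * k : ℝ))⁻¹
        ≤ C * ((gradW2kPow k (fun V => ft (mVec V.1 (x i)) V.2) Wstar) ^ ((2 * k : ℝ))⁻¹ + 1))
    (hδsmall : ∀ i, δ ≤ δa * l2norm (x i) / opNorm2 Wstar.1)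
    (hscatter : ∀ z : Fin d → ℝ,
      (∑ i, Set.indicator (eball (x i) δ) (fun _ => (1 : ℝ)) z) ≤ K) :
    (∫ z in ⋃ i, eball (x i) δ,
        ∑ j, |fderiv ℝ (fun u => ft (mVec Wstar.1 u) Wstar.2) z (Pi.single j 1)| ^ (2 * k))
          ^ ((2 * k : ℝ))⁻¹
      ≤ (K * (volume (⋃ i, eball (x i) δ)).toReal) ^ ((2 * k : ℝ))⁻¹ *
          (2 * C * opNormP k (fun s r => Wstar.1 r s)) /
          (Finset.univ.inf' ⟨⟨0, hn⟩, Finset.mem_univ _⟩ fun i => lpnorm k (x i)) *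
        ((((m * d + p : ℕ) : ℝ) / (B : ℝ)) ^ ((2 * k : ℝ))⁻¹ * Real.sqrt (2 * (B : ℝ) / η)
          + 1) := by
  set w : ℝ := ((m * d + p : ℕ) : ℝ)
  set A := opNormP k (fun s r => Wstar.1 r s)
  set μ := Finset.univ.inf' ⟨⟨0, hn⟩, Finset.mem_univ _⟩ fun i => lpnorm k (x i)
  set U := ⋃ i, eball (x i) δ
  set s := (w / (B : ℝ)) ^ ((2 * k : ℝ))⁻¹ * Real.sqrt (2 * (B : ℝ) / η)
  set G : Fin n → ℝ := fun i => gradW2kPow k (fun V => ft (mVec V.1 (x i)) V.2) Wstar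
  set v := (volume (eball (0 : Fin d → ℝ) δ)).toReal
  have hBpos : (0 : ℝ) < B := by exact_mod_cast hB
  have hs : 0 ≤ s := by positivity
  have hA : 0 ≤ A := opNormP_nonneg _ _
  have hG : ∀ i, 0 ≤ G i := fun i => gradW2kPow_nonneg _ _ _
  have hμpos : 0 < μ := by
    exact (Finset.lt_inf'_iff _).mpr fun i _ => lpnorm_pos hk (hx i)
  have hM : ∑ i, G i ≤ n * s ^ (2 * k) := by
    have hn' : (0 : ℝ) < n := by exact_mod_cast hn
    rw [moment_bound_eq hk (Nat.cast_nonneg _) hBpos hη, one_div, inv_mul_le_iff₀ hn'] at hmom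
    exact hmom
  have hvol : n * v ≤ K * (volume U).toReal := card_mul_volume_eball_le hscatter
  have hv : 0 ≤ v := ENNReal.toReal_nonneg
  have hKV : 0 ≤ K * (volume U).toReal := le_trans (by positivity) hvol
  set D := (A / μ * C) ^ (2 * k) * 2 ^ (2 * k - 1) with hD
  have hD0 : 0 ≤ D := by positivity
  have hpt : ∀ i, ∀ z ∈ eball (x i) δ,
      ∑ j, |fderiv ℝ (fun u => ft (mVec Wstar.1 u) Wstar.2) z (Pi.single j 1)| ^ (2 * k)
        ≤ D * (G i + 1) := fun i z hz => by
    obtain ⟨V, hVd, hV1, hV2⟩ := exists_params_mVec_eq (hx i) hδ (hδsmall i) hz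
    have h1 := sum_fderiv_input_pow_le hk hft hV1 hV2
    have h2 := pow_le_pow_left₀ (Real.rpow_nonneg (gradW2kPow_nonneg _ _ _) _)
      (hsmooth i V hVd) (2 * k)
    rw [rpow_inv_two_mul_pow hk (gradW2kPow_nonneg _ _ _), mul_pow] at h2
    have h3 := add_pow_le (Real.rpow_nonneg (hG i) ((2 * k : ℝ))⁻¹) zero_le_one (2 * k)
    rw [rpow_inv_two_mul_pow hk (hG i), one_pow] at h3
    have hμx : μ ≤ lpnorm k (x i) := Finset.inf'_le _ (Finset.mem_univ i)
    have h4 : (∑ j, |fderiv ℝ (fun u => ft (mVec Wstar.1 u) Wstar.2) z (Pi.single j 1)| ^ (2 * k))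
        * μ ^ (2 * k) ≤ A ^ (2 * k) * (C ^ (2 * k) * (2 ^ (2 * k - 1) * (G i + 1))) :=
      calc _ ≤ _ := by gcongr
        _ ≤ _ := h1
        _ ≤ _ := mul_le_mul_of_nonneg_left (h2.trans (by gcongr)) (by positivity)
    rw [← le_div_iff₀ (by positivity)] at h4
    refine h4.trans_eq ?_
    rw [hD, mul_pow, div_pow]
    ring
  have hint : ∫ z in U,
      ∑ j, |fderiv ℝ (fun u => ft (mVec Wstar.1 u) Wstar.2) z (Pi.single j 1)| ^ (2 * k)
        ≤ (∑ i, D * (G i + 1)) * v := by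
    rw [← setIntegral_sum_indicator_eball x δ]
    refine integral_mono_of_nonneg (Filter.Eventually.of_forall fun z => ?_)
      (integrableOn_sum_indicator_eball x δ _ _) ?_
    · exact Finset.sum_nonneg fun _ _ => by positivity
    · refine ae_restrict_of_forall_mem
        (MeasurableSet.iUnion fun i => (isClosed_eball _ _).measurableSet) fun z hz => ?_
      obtain ⟨i, hi⟩ := Set.mem_iUnion.mp hz
      refine (hpt i z hi).trans ?_
      refine le_trans (Set.indicator_of_mem hi (fun _ => D * (G i + 1))).ge
        (Finset.single_le_sum (f := fun i => (eball (x i) δ).indicator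
          (fun _ => D * (G i + 1)) z) (fun j _ => ?_) (Finset.mem_univ i))
      exact Set.indicator_nonneg (fun _ _ => mul_nonneg hD0 (by linarith [hG j])) _
  have hfin : (∑ i, D * (G i + 1)) * v
      ≤ ((K * (volume U).toReal) ^ ((2 * k : ℝ))⁻¹ * (2 * C * A) / μ * (s + 1)) ^ (2 * k) := by
    calc (∑ i, D * (G i + 1)) * v = D * ((∑ i, G i) + n) * v := by
          rw [← Finset.mul_sum, Finset.sum_add_distrib]
          simp
      _ ≤ D * (n * s ^ (2 * k) + n) * v := by gcongr
      _ = D * (s ^ (2 * k) + 1) * (n * v) := by ring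
      _ ≤ D * (s ^ (2 * k) + 1) * (K * (volume U).toReal) := by gcongr
      _ ≤ (A / μ * C) ^ (2 * k) * 2 ^ (2 * k) * (s + 1) ^ (2 * k) * (K * (volume U).toReal) := by
          have h5 := pow_add_pow_le hs zero_le_one (n := 2 * k) (by omega)
          rw [one_pow] at h5
          rw [hD]
          gcongr
          · norm_num
          · omega
      _ = _ := by
          rw [mul_pow _ (s + 1), div_pow _ μ, mul_pow (_ ^ _) (2 * C * A),
            rpow_inv_two_mul_pow hk hKV, mul_pow (A / μ), div_pow, mul_pow (2 * C), mul_pow 2 C]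
          ring
  refine (Real.rpow_le_rpow ?_ (hint.trans hfin) (by positivity)).trans_eq
    (pow_two_mul_rpow_inv hk ?_)
  · exact integral_nonneg fun z => Finset.sum_nonneg fun _ _ => by positivity
  · have := Real.rpow_nonneg hKV ((2 * k : ℝ))⁻¹
    positivity
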